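/- Let (X,T) be a compact metric dynamical system admitting a factor map π onto an aperiodic zero-dimensional system (Z,S), with mdim(X,T) < D/2 for a positive integer D. Then the set of continuous maps f: X → [0,1]^D for which (I_f, π): X → ([0,1]^D)^ℤ × Z is a topological embedding is a comeagre (residual) subset of C(X, [0,1]^D) with the uniform topology; in particular such an embedding exists. -/

import Mathlib

open scoped ENNReal NNReal
open Set Function Filter Topology

/-- The `n`-th iterate (`n ∈ ℤ`) of a homeomorphism. -/
noncomputable def hIter {X : Type*} [TopologicalSpace X] (T : X ≃ₜ X) (n : ℤ) (x : X) : X :=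
  if 0 ≤ n then (⇑T)^[n.toNat] x else (⇑T.symm)^[(-n).toNat] x

/-- `WidimLE d ε n`: there is a finite open cover of mesh `< ε` (w.r.t. the distance
function `d`) and of order `≤ n`, i.e. every point lies in at most `n+1` members
(equivalently any `n+2` distinct members have empty intersection). -/
def WidimLE {X : Type*} [TopologicalSpace X] (d : X → X → ℝ) (ε : ℝ) (n : ℕ) : Prop :=
  ∃ (N : ℕ) (U : Fin N → Set X),
    (∀ i, IsOpen (U i)) ∧ (⋃ i, U i) = Set.univ ∧
    (∀ i, ∀ x ∈ U i, ∀ y ∈ U i, d x y < ε) ∧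
    (∀ x : X, ({i | x ∈ U i} : Set (Fin N)).ncard ≤ n + 1)

/-- `widim d ε` : the ε-width dimension with respect to the distance function `d`. -/
noncomputable def widim {X : Type*} [TopologicalSpace X] (d : X → X → ℝ) (ε : ℝ) : ℝ≥0∞ :=
  sInf {c : ℝ≥0∞ | ∃ n : ℕ, c = n ∧ WidimLE d ε n}

/-- `dynDist T n` is the dynamical distance `d_0^{n-1}(x,y) = max_{0 ≤ i < n} d(T^i x, T^i y)`. -/
noncomputable def dynDist {X : Type*} [PseudoMetricSpace X] (T : X → X) (n : ℕ) (x y : X) : ℝ :=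
  (((Finset.range n).sup fun i => nndist (T^[i] x) (T^[i] y)) : ℝ≥0)

/-- Mean dimension `mdim(X,T) = sup_{ε>0} lim_n widim_ε(X, d_0^{n-1})/n`
(the limit exists, so it coincides with the limsup used here). -/
noncomputable def mdim {X : Type*} [MetricSpace X] (T : X → X) : ℝ≥0∞ :=
  ⨆ (ε : ℝ) (_ : 0 < ε), Filter.atTop.limsup fun n : ℕ => widim (dynDist T n) ε / (n : ℝ≥0∞)

/-- The left shift on `ℤ`-indexed sequences. -/
def shift {A : Type*} (x : ℤ → A) : ℤ → A := fun n => x (n + 1)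

/-- Points of the cube can be perturbed so that determinants of affine coordinates of any
`m + 1` of them do not vanish. -/
theorem exists_perturbation_det_ne_zero (K m : ℕ) (q : Fin K → Fin m → ℝ)
    (hq : ∀ i j, q i j ∈ Set.Icc (0 : ℝ) 1) {r : ℝ} (hr : 0 < r) :
    ∃ p : Fin K → Fin m → ℝ, (∀ i j, p i j ∈ Set.Icc (0 : ℝ) 1) ∧
      (∀ i j, |p i j - q i j| < r) ∧
      ∀ e : Fin (m + 1) ↪ Fin K,
        (Matrix.of fun a => (Fin.cons 1 (p (e a)) : Fin (m + 1) → ℝ)).det ≠ 0 := by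
  classical
  let t : Fin K → ℝ := fun i => 1 / ((i : ℕ) + 1 : ℝ)
  have ht0 : ∀ i, 0 ≤ t i := fun i => by positivity
  have ht1 : ∀ i, t i ≤ 1 := fun i => by
    have h : (1 : ℝ) ≤ (i : ℕ) + 1 := by
      have : (0 : ℝ) ≤ (i : ℕ) := Nat.cast_nonneg _
      linarith
    exact (div_le_one (by linarith)).2 h
  have htinj : Injective t := by
    intro i j hij
    have h : ((i : ℕ) + 1 : ℝ) = (j : ℕ) + 1 := by
      have := congrArg (fun x : ℝ => 1 / x) hij
      simpa [t] using this
    exact Fin.ext (by exact_mod_cast add_right_cancel h)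
  let P : (Fin (m + 1) ↪ Fin K) → Polynomial ℝ := fun e =>
    (Matrix.of fun a => (Fin.cons 1 fun j => Polynomial.C (q (e a) j) +
      Polynomial.X * Polynomial.C (t (e a) ^ ((j : ℕ) + 1) - q (e a) j) :
        Fin (m + 1) → Polynomial ℝ)).det
  have hPeval : ∀ e s, (P e).eval s = (Matrix.of fun a => (Fin.cons 1 fun j =>
      q (e a) j + s * (t (e a) ^ ((j : ℕ) + 1) - q (e a) j) : Fin (m + 1) → ℝ)).det := by
    intro e s
    rw [← Polynomial.coe_evalRingHom, RingHom.map_det]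
    congr 1
    ext a b
    refine Fin.cases ?_ (fun j => ?_) b <;> simp
  have hP : ∀ e, P e ≠ 0 := by
    intro e h0
    have h1 := hPeval e 1
    rw [h0, Polynomial.eval_zero] at h1
    have h2 : (Matrix.vandermonde fun a => t (e a)).det ≠ 0 :=
      Matrix.det_vandermonde_ne_zero_iff.2 (htinj.comp e.injective)
    refine h2 (Eq.trans ?_ h1.symm)
    congr 1
    ext a b
    refine Fin.cases ?_ (fun j => ?_) b <;> simp [Matrix.vandermonde]
  have hfin : (⋃ e, ((P e).roots.toFinset : Set ℝ)).Finite :=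
    Set.finite_iUnion fun e => Finset.finite_toSet _
  obtain ⟨s, hs, hsn⟩ := (Set.Ioo_infinite
    (show (0 : ℝ) < min 1 r from lt_min one_pos hr)).exists_notMem_finite hfin
  have hs1 : s < 1 := hs.2.trans_le (min_le_left _ _)
  have hsr : s < r := hs.2.trans_le (min_le_right _ _)
  have hpow : ∀ (i : Fin K) (j : Fin m), t i ^ ((j : ℕ) + 1) ∈ Set.Icc (0 : ℝ) 1 := fun i j =>
    ⟨pow_nonneg (ht0 i) _, pow_le_one₀ (ht0 i) (ht1 i)⟩
  refine ⟨fun i j => q i j + s * (t i ^ ((j : ℕ) + 1) - q i j), fun i j => ?_, fun i j => ?_,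
    fun e he => ?_⟩
  · have h1 := hpow i j
    have h2 := hq i j
    constructor
    · nlinarith [mul_nonneg hs.1.le h1.1, mul_nonneg (sub_nonneg.2 hs1.le) h2.1]
    · nlinarith [mul_nonneg hs.1.le (sub_nonneg.2 h1.2),
        mul_nonneg (sub_nonneg.2 hs1.le) (sub_nonneg.2 h2.2)]
  · have h1 := hpow i j
    have h2 := hq i j
    rw [add_sub_cancel_left, abs_mul, abs_of_pos hs.1]
    have h3 : |t i ^ ((j : ℕ) + 1) - q i j| ≤ 1 := by
      rw [abs_le]
      constructor <;> linarith [h1.1, h1.2, h2.1, h2.2]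
    nlinarith [hs.1]
  · refine hsn (Set.mem_iUnion.2 ⟨e, ?_⟩)
    rw [← hPeval] at he
    simpa [hP e] using he

/-- Points of the cube can be perturbed into general position: at most `m + 1` of them are
affinely independent. -/
theorem exists_perturbation_generalPosition (N m : ℕ) (q : Fin N → Fin m → ℝ)
    (hq : ∀ i j, q i j ∈ Set.Icc (0 : ℝ) 1) {r : ℝ} (hr : 0 < r) :
    ∃ p : Fin N → Fin m → ℝ, (∀ i j, p i j ∈ Set.Icc (0 : ℝ) 1) ∧
      (∀ i j, |p i j - q i j| < r) ∧
      ∀ w : Fin N → ℝ, ∀ s : Finset (Fin N), s.card ≤ m + 1 → (∀ i ∉ s, w i = 0) →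
        ∑ i, w i = 0 → (∀ j, ∑ i, w i * p i j = 0) → w = 0 := by
  classical
  obtain ⟨p, hp, hpq, hdet⟩ := exists_perturbation_det_ne_zero (N + (m + 1)) m
    (Fin.append q fun _ _ => 0) (fun i j => by
      refine Fin.addCases (fun i => ?_) (fun i => ?_) i
      · simpa using hq i j
      · simp) hr
  refine ⟨fun i => p (Fin.castAdd (m + 1) i), fun i j => hp _ j,
    fun i j => by simpa using hpq (Fin.castAdd (m + 1) i) j, ?_⟩
  intro w s hs hws hw0 hwp
  obtain ⟨u, hu, hcard⟩ : ∃ u : Finset (Fin (N + (m + 1))),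
      s.map (Fin.castAddEmb (m + 1)) ⊆ u ∧ u.card = m + 1 :=
    Finset.exists_superset_card_eq (by simpa using hs) (by simp)
  let w' : Fin (N + (m + 1)) → ℝ := Fin.append w fun _ => 0
  have hw'u : ∀ i ∉ u, w' i = 0 := by
    intro i
    refine Fin.addCases (fun i hi => ?_) (fun i hi => ?_) i
    · have : i ∉ s := fun h => hi (hu (Finset.mem_map.2 ⟨i, h, rfl⟩))
      simpa [w'] using hws i this
    · simp [w']
  have hsum : ∀ c : Fin (N + (m + 1)) → ℝ,
      ∑ i, w' i * c i = ∑ i, w i * c (Fin.castAdd (m + 1) i) := by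
    intro c
    rw [Fin.sum_univ_add]
    simp [w']
  let e : Fin (m + 1) ↪ Fin (N + (m + 1)) := (u.orderEmbOfFin hcard).toEmbedding
  have hsume : ∀ c : Fin (N + (m + 1)) → ℝ, ∑ a, w' (e a) * c (e a) = ∑ i, w' i * c i := by
    intro c
    have himg : Finset.univ.map e = u := by
      ext i
      simp [e]
    rw [← Finset.sum_map Finset.univ e fun i => w' i * c i, himg]
    exact Finset.sum_subset (Finset.subset_univ _) fun i _ hi => by simp [hw'u i hi]
  have hzero : (fun a => w' (e a)) = 0 := by
    refine Matrix.eq_zero_of_vecMul_eq_zero (hdet e) ?_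
    ext b
    refine Fin.cases ?_ (fun j => ?_) b
    · have := (hsume fun _ => 1).trans (hsum fun _ => 1)
      simpa [Matrix.vecMul, dotProduct, hw0] using this
    · have := (hsume fun i => p i j).trans (hsum fun i => p i j)
      simpa [Matrix.vecMul, dotProduct, hwp] using this
  ext i
  by_cases hi : i ∈ s
  · have hiu : Fin.castAdd (m + 1) i ∈ u := hu (Finset.mem_map.2 ⟨i, hi, rfl⟩)
    obtain ⟨a, ha⟩ : Fin.castAdd (m + 1) i ∈ Set.range (u.orderEmbOfFin hcard) := by
      rw [Finset.range_orderEmbOfFin]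
      exact hiu
    have h := congrFun hzero a
    have ha' : e a = Fin.castAdd (m + 1) i := ha
    rw [ha'] at h
    simpa [w'] using h
  · exact hws i hi

/-- A map into the cube `[0,1]^m` of oscillation `< δ` at scale `ε` can be approximated by an
`ε`-embedding when the `ε`-width dimension is less than `m / 2`. -/
theorem exists_approx_epsilonEmbedding {X : Type*} [MetricSpace X] [CompactSpace X]
    {d : X → X → ℝ} {ε δ : ℝ} (hδ : 0 < δ) {k m : ℕ} (hd : WidimLE d ε k) (hkm : 2 * k + 1 ≤ m)
    (F : X → Fin m → ℝ) (hF : ∀ x j, F x j ∈ Set.Icc (0 : ℝ) 1)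
    (hosc : ∀ x y, d x y < ε → ∀ j, |F x j - F y j| < δ) :
    ∃ G : X → Fin m → ℝ, Continuous G ∧ (∀ x j, G x j ∈ Set.Icc (0 : ℝ) 1) ∧
      (∀ x j, |G x j - F x j| ≤ 2 * δ) ∧ ∀ x y, G x = G y → d x y < ε := by
  classical
  obtain ⟨N, U, hUo, hUc, hUd, hUn⟩ := hd
  obtain ⟨φ, hφ⟩ := PartitionOfUnity.exists_isSubordinate (isClosed_univ (X := X)) U hUo hUc.ge
  have hφU : ∀ i x, φ i x ≠ 0 → x ∈ U i := fun i x h =>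
    hφ i (subset_tsupport _ h)
  have hφ1 : ∀ x, ∑ i, φ i x = 1 := fun x => by
    rw [← finsum_eq_sum_of_fintype]
    exact φ.sum_eq_one (Set.mem_univ x)
  have hq : ∀ i, ∃ q : Fin m → ℝ, (∀ j, q j ∈ Set.Icc (0 : ℝ) 1) ∧
      ∀ x ∈ U i, ∀ j, |q j - F x j| < δ := by
    intro i
    rcases (U i).eq_empty_or_nonempty with h | ⟨y, hy⟩
    · exact ⟨0, by simp, by simp [h]⟩
    · exact ⟨F y, hF y, fun x hx => hosc y x (hUd i y hy x hx)⟩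
  choose q hq01 hqF using hq
  obtain ⟨p, hp01, hpq, hpw⟩ := exists_perturbation_generalPosition N m q hq01 hδ
  have hconst : ∀ (x : X) (c : ℝ), ∑ i, φ i x * c = c := fun x c => by
    rw [← Finset.sum_mul, hφ1, one_mul]
  refine ⟨fun x j => ∑ i, φ i x * p i j, ?_, fun x j => ⟨?_, ?_⟩, fun x j => ?_, fun x y hxy => ?_⟩
  · refine continuous_pi fun j => continuous_finsetSum _ fun i _ => ?_
    exact (φ i).continuous.mul continuous_const
  · exact Finset.sum_nonneg fun i _ => mul_nonneg (φ.nonneg i x) (hp01 i j).1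
  · rw [← hconst x 1]
    exact Finset.sum_le_sum fun i _ => mul_le_mul_of_nonneg_left (hp01 i j).2 (φ.nonneg i x)
  · have h1 : ∑ i, φ i x * p i j - F x j = ∑ i, φ i x * (p i j - F x j) := by
      simp only [mul_sub, Finset.sum_sub_distrib, hconst]
    rw [h1, ← hconst x (2 * δ)]
    refine (Finset.abs_sum_le_sum_abs _ _).trans (Finset.sum_le_sum fun i _ => ?_)
    rw [abs_mul, abs_of_nonneg (φ.nonneg i x)]
    by_cases h0 : φ i x = 0
    · simp [h0]
    · refine mul_le_mul_of_nonneg_left ?_ (φ.nonneg i x)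
      have h2 := hqF i x (hφU i x h0) j
      have h3 := hpq i j
      have h4 := abs_sub_le (p i j) (q i j) (F x j)
      linarith
  · let A : X → Finset (Fin N) := fun z => Finset.univ.filter fun i => z ∈ U i
    have hA : ∀ z, (A z).card ≤ k + 1 := fun z => by
      have := hUn z
      rwa [Set.ncard_eq_toFinset_card', Set.toFinset_ofPred] at this
    have hA0 : ∀ z, ∀ i ∉ A z, φ i z = 0 := fun z i hi => by
      by_contra h
      exact hi (by simpa [A] using hφU i z h)
    have hw := hpw (fun i => φ i x - φ i y) (A x ∪ A y)
      ((Finset.card_union_le _ _).trans (by linarith [hA x, hA y]))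
      (fun i hi => by
        rw [Finset.mem_union, not_or] at hi
        rw [hA0 x i hi.1, hA0 y i hi.2, sub_zero])
      (by rw [Finset.sum_sub_distrib, hφ1, hφ1, sub_self])
      (fun j => by
        have := congrFun hxy j
        simp only [sub_mul, Finset.sum_sub_distrib]
        exact sub_eq_zero.2 this)
    obtain ⟨i, hi⟩ : ∃ i, φ i x ≠ 0 := by
      by_contra! h
      have := hφ1 x
      simp [h] at this
    have hiy : φ i y ≠ 0 := by
      have := congrFun hw i
      simp only [Pi.zero_apply, sub_eq_zero] at this
      rwa [← this]
    exact hUd i x (hφU i x hi) y (hφU i y hiy)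

theorem hIter_eq_zpow {X : Type*} [TopologicalSpace X] (T : X ≃ₜ X) (n : ℤ) (x : X) :
    hIter T n x = (T ^ n) x := by
  have hpow : ∀ (R : X ≃ₜ X) (k : ℕ) (x : X), (R ^ k) x = (⇑R)^[k] x := by
    intro R k
    induction k with
    | zero => intro x; rfl
    | succ k ih =>
      intro x
      rw [pow_succ, iterate_succ_apply, ← ih]
      rfl
  unfold hIter
  split_ifs with h
  · obtain ⟨k, rfl⟩ := Int.eq_ofNat_of_zero_le h
    rw [Int.toNat_natCast, zpow_natCast, hpow]
  · obtain ⟨k, hk⟩ := Int.eq_ofNat_of_zero_le (show 0 ≤ -n by omega)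
    obtain rfl : n = -(k : ℤ) := by omega
    rw [neg_neg, Int.toNat_natCast, zpow_neg, zpow_natCast, ← inv_pow, hpow]
    rfl

theorem Homeomorph.coe_pow_eq_iterate {X : Type*} [TopologicalSpace X] (T : X ≃ₜ X) (n : ℕ)
    (x : X) : (T ^ (n : ℤ)) x = (⇑T)^[n] x := by
  rw [← hIter_eq_zpow]
  simp [hIter]

theorem Homeomorph.zpow_apply_zpow_apply {X : Type*} [TopologicalSpace X] (T : X ≃ₜ X) (m n : ℤ)
    (x : X) : (T ^ m) ((T ^ n) x) = (T ^ (m + n)) x := by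
  rw [zpow_add]
  rfl

theorem Homeomorph.zpow_semiconj {X Z : Type*} [TopologicalSpace X] [TopologicalSpace Z]
    {T : X ≃ₜ X} {S : Z ≃ₜ Z} {π : X → Z} (h : ∀ x, π (T x) = S (π x)) (n : ℤ) (x : X) :
    π ((T ^ n) x) = (S ^ n) (π x) := by
  have hnat : ∀ (n : ℕ) (x : X), π ((T ^ (n : ℤ)) x) = (S ^ (n : ℤ)) (π x) := by
    intro n x
    rw [coe_pow_eq_iterate, coe_pow_eq_iterate]
    exact (show Semiconj π T S from h).iterate_right n x
  rcases Int.eq_nat_or_neg n with ⟨k, rfl | rfl⟩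
  · exact hnat k x
  · have h1 := hnat k ((T ^ (-(k : ℤ))) x)
    rw [zpow_apply_zpow_apply, add_neg_cancel] at h1
    have h2 : (S ^ (-(k : ℤ))) (π x) =
        (S ^ (-(k : ℤ))) ((S ^ (k : ℤ)) (π ((T ^ (-(k : ℤ))) x))) := by
      rw [← h1]
      rfl
    rw [h2, zpow_apply_zpow_apply, neg_add_cancel]
    rfl

/-- Clopen marker lemma: an aperiodic homeomorphism of a zero-dimensional compact space has a
clopen set whose first `N - 1` translates miss it and whose translates cover the space. -/
theorem exists_isClopen_marker {Z : Type*} [MetricSpace Z] [CompactSpace Z]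
    [TotallyDisconnectedSpace Z] (S : Z ≃ₜ Z)
    (hap : ∀ (z : Z) (n : ℕ), 0 < n → (⇑S)^[n] z ≠ z) {N : ℤ} (hN : 0 ≤ N) :
    ∃ U : Set Z, IsClopen U ∧ (∀ z ∈ U, ∀ n : ℤ, 0 < n → n < N → (S ^ n) z ∉ U) ∧
      ∀ z, ∃ i : ℤ, -N ≤ i ∧ i ≤ N ∧ (S ^ i) z ∈ U := by
  have hcl : ∀ (n : ℤ) {V : Set Z}, IsClopen V → IsClopen ((S ^ n) ⁻¹' V) := fun n V hV =>
    hV.preimage (S ^ n).continuous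
  have hloc : ∀ z, ∃ V : Set Z, z ∈ V ∧ IsClopen V ∧
      ∀ y ∈ V, ∀ n : ℤ, 0 < n → n < N → (S ^ n) y ∉ V := by
    intro z
    have h : ∀ n : ℤ, ∃ W : Set Z, z ∈ W ∧ IsClopen W ∧ (0 < n → (S ^ n) z ∉ W) := by
      intro n
      by_cases hn : 0 < n
      · have hne : z ≠ (S ^ n) z := by
          obtain ⟨k, rfl⟩ := Int.eq_ofNat_of_zero_le hn.le
          rw [Homeomorph.coe_pow_eq_iterate]
          exact (hap z k (by exact_mod_cast hn)).symm
        obtain ⟨W, hW, hz, hSz⟩ := exists_isClopen_of_totally_separated hne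
        exact ⟨W, hz, hW, fun _ => hSz⟩
      · exact ⟨univ, mem_univ z, isClopen_univ, fun h => absurd h hn⟩
    choose W hzW hW hSW using h
    refine ⟨⋂ n ∈ Finset.Ioo 0 N, W n ∩ (S ^ n) ⁻¹' (W n)ᶜ, ?_, ?_, ?_⟩
    · simp only [mem_iInter, Finset.mem_Ioo]
      exact fun n hn => ⟨hzW n, hSW n hn.1⟩
    · exact isClopen_biInter_finset fun n _ => (hW n).inter (hcl n (hW n).compl)
    · intro y hy n h0 hn hSy
      simp only [mem_iInter, Finset.mem_Ioo] at hy hSy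
      exact (hy n ⟨h0, hn⟩).2 (hSy n ⟨h0, hn⟩).1
  choose V hzV hV hVS using hloc
  have hfin : ∀ t : Finset Z, ∃ U : Set Z, IsClopen U ∧
      (∀ z ∈ U, ∀ n : ℤ, 0 < n → n < N → (S ^ n) z ∉ U) ∧
      ∀ c ∈ t, ∀ z ∈ V c, ∃ i : ℤ, -N ≤ i ∧ i ≤ N ∧ (S ^ i) z ∈ U := by
    classical
    intro t
    induction t using Finset.induction_on with
    | empty => exact ⟨∅, isClopen_empty, by simp, by simp⟩
    | insert c t _ ih =>
      obtain ⟨U, hU, hUS, hUt⟩ := ih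
      let B : Set Z := ⋃ i ∈ Finset.Icc (-N) N, (S ^ i) ⁻¹' U
      have hB : IsClopen B := isClopen_biUnion_finset fun i _ => hcl i hU
      have hBmem : ∀ {z} {i : ℤ}, -N ≤ i → i ≤ N → (S ^ i) z ∈ U → z ∈ B := by
        intro z i h1 h2 h3
        simp only [B, mem_iUnion, Finset.mem_Icc]
        exact ⟨i, ⟨h1, h2⟩, h3⟩
      refine ⟨U ∪ V c \ B, hU.union ((hV c).diff hB), ?_, ?_⟩
      · rintro z (hz | hz) n h0 hn (hS | hS)
        · exact hUS z hz n h0 hn hS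
        · refine hS.2 (hBmem (i := -n) (by omega) (by omega) ?_)
          rw [Homeomorph.zpow_apply_zpow_apply, neg_add_cancel]
          exact hz
        · exact hz.2 (hBmem (by omega) hn.le hS)
        · exact hVS c z hz.1 n h0 hn hS.1
      · intro c' hc' z hz
        rcases Finset.mem_insert.1 hc' with rfl | hc'
        · by_cases hzB : z ∈ B
          · simp only [B, mem_iUnion, Finset.mem_Icc] at hzB
            obtain ⟨i, ⟨h1, h2⟩, h3⟩ := hzB
            exact ⟨i, h1, h2, Or.inl h3⟩
          · exact ⟨0, by omega, hN, Or.inr ⟨hz, hzB⟩⟩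
        · obtain ⟨i, h1, h2, h3⟩ := hUt c' hc' z hz
          exact ⟨i, h1, h2, Or.inl h3⟩
  obtain ⟨t, ht⟩ := isCompact_univ.elim_finite_subcover V (fun z => (hV z).isOpen)
    fun z _ => mem_iUnion.2 ⟨z, hzV z⟩
  obtain ⟨U, hU, hUS, hUt⟩ := hfin t
  refine ⟨U, hU, hUS, fun z => ?_⟩
  obtain ⟨c, hc, hzc⟩ := mem_iUnion₂.1 (ht (mem_univ z))
  exact hUt c hc z hzc

theorem isLocallyConstant_natFind {Z : Type*} [TopologicalSpace Z] {P : ℕ → Set Z}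
    (hP : ∀ n, IsClopen (P n)) [∀ z, DecidablePred fun n => z ∈ P n]
    (h : ∀ z, ∃ n, z ∈ P n) : IsLocallyConstant fun z => Nat.find (h z) := by
  rw [IsLocallyConstant.iff_eventually_eq]
  intro z
  have h1 : ∀ᶠ y in 𝓝 z, y ∈ P (Nat.find (h z)) :=
    (hP _).isOpen.mem_nhds (Nat.find_spec (h z))
  have h2 : ∀ᶠ y in 𝓝 z, ∀ m ∈ Finset.range (Nat.find (h z)), y ∉ P m :=
    (Finset.eventually_all _).2 fun m hm =>
      (hP m).compl.isOpen.mem_nhds (Nat.find_min (h z) (Finset.mem_range.1 hm))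
  filter_upwards [h1, h2] with y hy1 hy2
  exact (Nat.find_eq_iff _).2 ⟨hy1, fun m hm => hy2 m (Finset.mem_range.2 hm)⟩

theorem eventually_widimLE_of_mdim_lt {X : Type*} [MetricSpace X] {T : X → X} {D : ℕ}
    (h : mdim T < (D : ℝ≥0∞) / 2) {ε : ℝ} (hε : 0 < ε) :
    ∀ᶠ n : ℕ in atTop, ∃ k, WidimLE (dynDist T n) ε k ∧ 2 * k + 1 ≤ n * D := by
  have hlim : atTop.limsup (fun n : ℕ => widim (dynDist T n) ε / (n : ℝ≥0∞)) <
      (D : ℝ≥0∞) / 2 :=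
    (le_iSup₂ (f := fun (ε : ℝ) (_ : 0 < ε) =>
      atTop.limsup fun n : ℕ => widim (dynDist T n) ε / (n : ℝ≥0∞)) ε hε).trans_lt h
  filter_upwards [eventually_lt_of_limsup_lt hlim, eventually_gt_atTop 0] with n hn hn0
  have hn' : (n : ℝ≥0∞) ≠ 0 := by exact_mod_cast hn0.ne'
  rw [ENNReal.div_lt_iff (Or.inl hn') (Or.inl (ENNReal.natCast_ne_top n))] at hn
  obtain ⟨_, ⟨k, rfl, hk⟩, hlt⟩ := sInf_lt_iff.1 hn
  refine ⟨k, hk, ?_⟩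
  have h2 : (2 : ℝ≥0∞) * k < n * D := by
    calc (2 : ℝ≥0∞) * k < 2 * ((D : ℝ≥0∞) / 2 * n) :=
          (ENNReal.mul_lt_mul_iff_right two_ne_zero ENNReal.ofNat_ne_top).2 hlt
      _ = n * D := by
          rw [← mul_assoc, ENNReal.mul_div_cancel two_ne_zero ENNReal.ofNat_ne_top, mul_comm]
  have h3 : 2 * k < n * D := by exact_mod_cast h2
  omega

theorem dist_iterate_le_dynDist {X : Type*} [PseudoMetricSpace X] (T : X → X) {i n : ℕ}
    (hi : i < n) (x y : X) : dist (T^[i] x) (T^[i] y) ≤ dynDist T n x y := by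
  have := Finset.le_sup (f := fun i => nndist (T^[i] x) (T^[i] y)) (Finset.mem_range.2 hi)
  exact_mod_cast this

/-- Orbit segments of length `n` of `f` can be approximated by an `ε`-embedding. -/
theorem exists_approx_orbitSegment {X : Type*} [MetricSpace X] [CompactSpace X] {T : X → X}
    {D : ℕ} (f : C(X, Fin D → Set.Icc (0 : ℝ) 1)) {ε δ : ℝ} (hδ : 0 < δ)
    (hf : ∀ x y, dist x y < ε → dist (f x) (f y) < δ) {n k : ℕ}
    (hd : WidimLE (dynDist T n) ε k) (hk : 2 * k + 1 ≤ n * D) :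
    ∃ F : ℕ → X → Fin D → Set.Icc (0 : ℝ) 1, (∀ i, Continuous (F i)) ∧
      (∀ i < n, ∀ x, dist (F i x) (f (T^[i] x)) ≤ 2 * δ) ∧
      ∀ x y, (∀ i < n, F i x = F i y) → dynDist T n x y < ε := by
  obtain ⟨G, hGc, hG01, hGf, hGε⟩ := exists_approx_epsilonEmbedding hδ hd hk
    (fun x j => (f (T^[(finProdFinEquiv.symm j).1] x) (finProdFinEquiv.symm j).2 : ℝ))
    (fun x j => Subtype.prop _)
    (fun x y hxy j => by
      refine lt_of_le_of_lt ?_ (hf _ _ ((dist_iterate_le_dynDist T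
        (finProdFinEquiv.symm j).1.isLt x y).trans_lt hxy))
      exact dist_le_pi_dist (f _) (f _) (finProdFinEquiv.symm j).2)
  refine ⟨fun i x c => if h : i < n then ⟨G x (finProdFinEquiv (⟨i, h⟩, c)), hG01 _ _⟩ else 0,
    fun i => continuous_pi fun c => ?_, fun i hi x => ?_, fun x y hxy => hGε x y ?_⟩
  · by_cases h : i < n
    · simp only [h, dif_pos]
      exact ((continuous_apply _).comp hGc).subtype_mk _
    · simp only [h, dif_neg, not_false_iff]
      exact continuous_const
  · refine (dist_pi_le_iff (by positivity)).2 fun c => ?_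
    simp only [hi, dif_pos]
    have := hGf x (finProdFinEquiv (⟨i, hi⟩, c))
    rw [Equiv.symm_apply_apply] at this
    exact this
  · ext j
    obtain ⟨⟨i, c⟩, rfl⟩ := finProdFinEquiv.surjective j
    have := congrArg Subtype.val (congrFun (hxy i i.isLt) c)
    simpa using this

/-- The functions `f` for which `(I_f, π)` is an `η`-embedding form an open set. -/
theorem isOpen_setOf_epsilonEmbedding {X Y Z : Type*} [MetricSpace X] [CompactSpace X]
    [TopologicalSpace Y] [T2Space Y] [TopologicalSpace Z] [T2Space Z] (T : X ≃ₜ X) {π : X → Z}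
    (hπ : Continuous π) (η : ℝ) :
    IsOpen {f : C(X, Y) | ∀ x y, π x = π y →
      (∀ n : ℤ, f ((T ^ n) x) = f ((T ^ n) y)) → dist x y < η} := by
  let C : Set (C(X, Y) × X × X) := {p | η ≤ dist p.2.1 p.2.2} ∩ {p | π p.2.1 = π p.2.2} ∩
    ⋂ n : ℤ, {p | p.1 ((T ^ n) p.2.1) = p.1 ((T ^ n) p.2.2)}
  have hC : IsClosed C := by
    refine ((isClosed_le (by fun_prop) (by fun_prop)).inter
      (isClosed_eq (by fun_prop) (by fun_prop))).inter (isClosed_iInter fun n => ?_)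
    have hT : Continuous (T ^ n : X ≃ₜ X) := (T ^ n).continuous
    refine isClosed_eq ?_ ?_
    · exact continuous_eval.comp
        (continuous_fst.prodMk (hT.comp (continuous_fst.comp continuous_snd)))
    · exact continuous_eval.comp
        (continuous_fst.prodMk (hT.comp (continuous_snd.comp continuous_snd)))
  rw [← isClosed_compl_iff]
  convert isClosedMap_fst_of_compactSpace C hC using 1
  ext f
  simp only [mem_compl_iff, mem_ofPred_eq, not_forall, not_lt, mem_image, Prod.exists, C,
    mem_inter_iff, mem_iInter]
  constructor
  · rintro ⟨x, y, h1, h2, h3⟩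
    exact ⟨f, x, y, ⟨⟨h3, h1⟩, h2⟩, rfl⟩
  · rintro ⟨_, x, y, ⟨⟨h3, h1⟩, h2⟩, rfl⟩
    exact ⟨x, y, h1, h2, h3⟩

/-- A clopen marker set yields locally constant times `a` since the last visit and `b` until the
next one, compatible along orbit segments between consecutive visits. -/
theorem exists_locallyConstant_visitTimes {Z : Type*} [TopologicalSpace Z] {S : Z ≃ₜ Z} {U : Set Z}
    (hU : IsClopen U) {N : ℕ}
    (hUS : ∀ z ∈ U, ∀ n : ℤ, 0 < n → n < N → (S ^ n) z ∉ U)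
    (hcov : ∀ z, ∃ i : ℤ, -N ≤ i ∧ i ≤ N ∧ (S ^ i) z ∈ U) :
    ∃ a b : Z → ℕ, IsLocallyConstant a ∧ IsLocallyConstant b ∧ (∀ z, 0 < b z) ∧
      (∀ z, N ≤ a z + b z) ∧
      ∀ z, ∀ j < a z + b z, a ((S ^ ((j : ℤ) - a z)) z) = j ∧
        b ((S ^ ((j : ℤ) - a z)) z) = a z + b z - j := by
  classical
  have hcl : ∀ n : ℤ, IsClopen ((S ^ n) ⁻¹' U) := fun n => hU.preimage (S ^ n).continuous
  have hpast : ∀ z, ∃ n : ℕ, z ∈ (S ^ (-(n : ℤ))) ⁻¹' U := by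
    intro z
    obtain ⟨i, hi1, hi2, hi⟩ := hcov ((S ^ (-(N : ℤ))) z)
    rw [Homeomorph.zpow_apply_zpow_apply] at hi
    refine ⟨(N - i).toNat, ?_⟩
    rw [mem_preimage, show -((N - i).toNat : ℤ) = i + -N by omega]
    exact hi
  have hfut : ∀ z, ∃ n : ℕ, z ∈ (if n = 0 then ∅ else (S ^ (n : ℤ)) ⁻¹' U : Set Z) := by
    intro z
    obtain ⟨i, hi1, hi2, hi⟩ := hcov ((S ^ ((N : ℤ) + 1)) z)
    rw [Homeomorph.zpow_apply_zpow_apply] at hi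
    refine ⟨(N + 1 + i).toNat, ?_⟩
    rw [if_neg (by omega), mem_preimage,
      show ((N + 1 + i).toNat : ℤ) = i + (N + 1) by omega]
    exact hi
  have hb : ∀ z, 0 < Nat.find (hfut z) ∧ (S ^ (Nat.find (hfut z) : ℤ)) z ∈ U := by
    intro z
    have := Nat.find_spec (hfut z)
    split_ifs at this with h
    · exact this.elim
    · exact ⟨Nat.pos_of_ne_zero h, this⟩
  have ha : ∀ z, (S ^ (-(Nat.find (hpast z) : ℤ))) z ∈ U := fun z => Nat.find_spec (hpast z)
  have hbetween : ∀ z, ∀ c : ℤ, -(Nat.find (hpast z) : ℤ) < c → c < Nat.find (hfut z) →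
      (S ^ c) z ∉ U := by
    intro z c h1 h2 hc
    rcases le_or_gt c 0 with h0 | h0
    · refine Nat.find_min (hpast z) (m := (-c).toNat) (by omega) ?_
      rwa [mem_preimage, show -((-c).toNat : ℤ) = c by omega]
    · refine Nat.find_min (hfut z) (m := c.toNat) (by omega) ?_
      rwa [if_neg (by omega), mem_preimage, show (c.toNat : ℤ) = c by omega]
  refine ⟨fun z => Nat.find (hpast z), fun z => Nat.find (hfut z),
    isLocallyConstant_natFind (fun n => hcl _) hpast,
    isLocallyConstant_natFind (fun n => ?_) hfut, fun z => (hb z).1, fun z => ?_,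
    fun z j hj => ?_⟩
  · split_ifs
    · exact isClopen_empty
    · exact hcl _
  · by_contra! hlt
    have hpos := (hb z).1
    refine hUS _ (ha z) (Nat.find (hpast z) + Nat.find (hfut z)) (by omega) (by omega) ?_
    rw [Homeomorph.zpow_apply_zpow_apply, add_neg_cancel_comm]
    exact (hb z).2
  beta_reduce at hj ⊢
  constructor
  · refine (Nat.find_eq_iff _).2 ⟨?_, fun m hm => ?_⟩
    · rw [mem_preimage, Homeomorph.zpow_apply_zpow_apply, neg_add_eq_sub, sub_sub_cancel_left]
      exact ha z
    · rw [mem_preimage, Homeomorph.zpow_apply_zpow_apply]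
      exact hbetween z _ (by omega) (by omega)
  · refine (Nat.find_eq_iff _).2 ⟨?_, fun m hm => ?_⟩
    · rw [if_neg (by omega), mem_preimage, Homeomorph.zpow_apply_zpow_apply]
      convert (hb z).2 using 3
      omega
    · split_ifs with h0
      · exact notMem_empty _
      · rw [mem_preimage, Homeomorph.zpow_apply_zpow_apply]
        exact hbetween z _ (by omega) (by omega)

/-- The functions `f` for which `(I_f, π)` is an `η`-embedding form a dense set. -/
theorem dense_setOf_epsilonEmbedding {X Z : Type*} [MetricSpace X] [CompactSpace X]
    [MetricSpace Z] [CompactSpace Z] [TotallyDisconnectedSpace Z]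
    (T : X ≃ₜ X) (S : Z ≃ₜ Z)
    (hap : ∀ (z : Z) (n : ℕ), 0 < n → (⇑S)^[n] z ≠ z)
    {π : X → Z} (hπc : Continuous π) (hπe : ∀ x, π (T x) = S (π x))
    {D : ℕ} (hmdim : mdim ⇑T < (D : ℝ≥0∞) / 2) {η : ℝ} (hη : 0 < η) :
    Dense {f : C(X, Fin D → Set.Icc (0 : ℝ) 1) | ∀ x y, π x = π y →
      (∀ n : ℤ, f ((T ^ n) x) = f ((T ^ n) y)) → dist x y < η} := by
  refine Metric.dense_iff.2 fun f δ hδ => ?_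
  obtain ⟨ε₀, hε₀, hf⟩ := Metric.uniformContinuous_iff.1
    (CompactSpace.uniformContinuous_of_continuous f.continuous) (δ / 4) (by positivity)
  obtain ⟨N₀, hN₀⟩ := eventually_atTop.1
    (eventually_widimLE_of_mdim_lt hmdim (lt_min hε₀ hη))
  have hF : ∀ n, N₀ ≤ n → ∃ F : ℕ → X → Fin D → Set.Icc (0 : ℝ) 1, (∀ i, Continuous (F i)) ∧
      (∀ i < n, ∀ x, dist (F i x) (f ((⇑T)^[i] x)) ≤ 2 * (δ / 4)) ∧
      ∀ x y, (∀ i < n, F i x = F i y) → dynDist T n x y < min ε₀ η := by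
    intro n hn
    obtain ⟨k, hk, hkn⟩ := hN₀ n hn
    exact exists_approx_orbitSegment f (by positivity)
      (fun x y hxy => hf (hxy.trans_le (min_le_left _ _))) hk hkn
  choose! F hFc hFf hFε using hF
  obtain ⟨U, hU, hUS, hcov⟩ := exists_isClopen_marker S hap
    (N := ((N₀ + 1 : ℕ) : ℤ)) (Int.natCast_nonneg _)
  obtain ⟨a, b, ha, hb, hbpos, hNab, hab⟩ :=
    exists_locallyConstant_visitTimes hU hUS hcov
  have hN₀ab : ∀ z, N₀ ≤ a z + b z := fun z => (Nat.le_succ N₀).trans (hNab z)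
  let g : C(X, Fin D → Set.Icc (0 : ℝ) 1) :=
    { toFun := fun x => F (a (π x) + b (π x)) (a (π x)) ((T ^ (-(a (π x) : ℤ))) x)
      continuous_toFun := by
        refine continuous_iff_continuousAt.2 fun x => ?_
        have hx : ContinuousAt (fun y => F (a (π x) + b (π x)) (a (π x))
            ((T ^ (-(a (π x) : ℤ))) y)) x :=
          ((hFc _ (hN₀ab _) _).comp (T ^ (-(a (π x) : ℤ))).continuous).continuousAt
        refine hx.congr ?_
        filter_upwards [hπc.continuousAt.eventually (ha.eventually_eq (π x)),
          hπc.continuousAt.eventually (hb.eventually_eq (π x))] with y hya hyb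
        rw [hya, hyb] }
  have hg : ∀ x, ∀ j < a (π x) + b (π x), g ((T ^ ((j : ℤ) - a (π x))) x) =
      F (a (π x) + b (π x)) j ((T ^ (-(a (π x) : ℤ))) x) := by
    intro x j hj
    obtain ⟨h1, h2⟩ := hab (π x) j hj
    change F _ _ _ = _
    rw [Homeomorph.zpow_semiconj hπe, h1, h2, Homeomorph.zpow_apply_zpow_apply,
      Nat.add_sub_cancel' hj.le, neg_add_eq_sub, sub_sub_cancel_left]
  refine ⟨g, Metric.mem_ball.2 ((ContinuousMap.dist_lt_iff hδ).2 fun x => ?_),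
    fun x y hxy hgxy => ?_⟩
  · have h := hFf _ (hN₀ab (π x)) (a (π x)) (Nat.lt_add_of_pos_right (hbpos _))
      ((T ^ (-(a (π x) : ℤ))) x)
    rw [← Homeomorph.coe_pow_eq_iterate, Homeomorph.zpow_apply_zpow_apply, add_neg_cancel] at h
    refine lt_of_le_of_lt h ?_
    linarith
  · have h := hFε _ (hN₀ab (π x)) ((T ^ (-(a (π x) : ℤ))) x) ((T ^ (-(a (π x) : ℤ))) y)
      fun j hj => by
        rw [← hg x j hj, hgxy, hxy, ← hg y j (hxy ▸ hj)]
    have h' := (dist_iterate_le_dynDist T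
      (Nat.lt_add_of_pos_right (hbpos (π x)) : a (π x) < a (π x) + b (π x)) _ _).trans_lt h
    rw [← Homeomorph.coe_pow_eq_iterate, ← Homeomorph.coe_pow_eq_iterate,
      Homeomorph.zpow_apply_zpow_apply, Homeomorph.zpow_apply_zpow_apply, add_neg_cancel] at h'
    exact h'.trans_le (min_le_right _ _)

/-- Main theorem: if `π : (X,T) → (Z,S)` is a factor map onto an aperiodic
zero-dimensional system and `mdim(X,T) < D/2`, then the set of continuous maps
`f : X → [0,1]^D` for which `(I_f, π) : X → ([0,1]^D)^ℤ × Z` is a topological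
embedding is comeagre (residual) in `C(X,[0,1]^D)` (with the uniform = compact-open
topology); in particular such an embedding exists. -/
theorem stmt8 {X Z : Type*} [MetricSpace X] [CompactSpace X]
    [MetricSpace Z] [CompactSpace Z] [TotallyDisconnectedSpace Z]
    (T : X ≃ₜ X) (S : Z ≃ₜ Z)
    (hap : ∀ (z : Z) (n : ℕ), 0 < n → (⇑S)^[n] z ≠ z)
    (π : X → Z) (hπc : Continuous π) (hπs : Function.Surjective π)
    (hπe : ∀ x, π (T x) = S (π x))
    (D : ℕ) (hD : 0 < D) (hmdim : mdim ⇑T < (D : ℝ≥0∞) / 2) :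
    {f : C(X, Fin D → Set.Icc (0:ℝ) 1) |
        Topology.IsEmbedding (fun x : X => ((fun n : ℤ => f (hIter T n x)), π x))} ∈
      residual C(X, Fin D → Set.Icc (0:ℝ) 1) := by
  have hη : ∀ k : ℕ, (0 : ℝ) < 1 / (k + 1) := fun k => Nat.one_div_pos_of_nat
  have hres : (⋂ k : ℕ, {f : C(X, Fin D → Set.Icc (0 : ℝ) 1) | ∀ x y, π x = π y →
      (∀ n : ℤ, f ((T ^ n) x) = f ((T ^ n) y)) → dist x y < 1 / (k + 1)}) ∈
      residual C(X, Fin D → Set.Icc (0 : ℝ) 1) :=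
    countable_iInter_mem.2 fun k => residual_of_dense_open
      (isOpen_setOf_epsilonEmbedding T hπc _)
      (dense_setOf_epsilonEmbedding T S hap hπc hπe hmdim (hη k))
  refine mem_of_superset hres fun f hf => ?_
  have hcont : Continuous fun x : X => ((fun n : ℤ => f (hIter T n x)), π x) := by
    refine Continuous.prodMk (continuous_pi fun n => ?_) hπc
    simp only [hIter_eq_zpow]
    exact f.continuous.comp (T ^ n).continuous
  refine (hcont.isClosedEmbedding fun x y hxy => ?_).isEmbedding
  obtain ⟨h1, h2⟩ := Prod.mk.inj hxy
  by_contra hne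
  obtain ⟨k, hk⟩ := exists_nat_one_div_lt (dist_pos.2 hne)
  refine (mem_iInter.1 hf k x y h2 fun n => ?_).not_gt hk
  simpa only [hIter_eq_zpow] using congrFun h1 n
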